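/- arXiv:2312.02099 — 4 statements merged into one kernel-verified Lean document; each statement's English description precedes it below -/
import Mathlib

section
/- Let $U$, $V$, $W$ be finite-dimensional real inner product spaces, and let $f : W \to V$ and $g : V \to U$ be linear maps with $g \circ f = 0$. Then the dimension of the kernel of the Laplacian $\Delta = f \circ f^* + g^* \circ g : V \to V$ equals $\dim(\ker g) - \dim(\operatorname{range} f)$, i.e. the dimension of the homology $\ker g / \operatorname{range} f$ at $V$. -/
/-- The harmonic space `ker (f ∘ f* + g* ∘ g)` is the part of `ker g` orthogonal to `range f`. -/
theorem ker_laplacian_eq_orthogonal_range_inf_ker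
    {U V W : Type*}
    [NormedAddCommGroup U] [InnerProductSpace ℝ U] [FiniteDimensional ℝ U]
    [NormedAddCommGroup V] [InnerProductSpace ℝ V] [FiniteDimensional ℝ V]
    [NormedAddCommGroup W] [InnerProductSpace ℝ W] [FiniteDimensional ℝ W]
    (f : W →ₗ[ℝ] V) (g : V →ₗ[ℝ] U) :
    LinearMap.ker (f ∘ₗ LinearMap.adjoint f + LinearMap.adjoint g ∘ₗ g) =
      (LinearMap.range f)ᗮ ⊓ LinearMap.ker g := by
  have mem_orthogonal (x : V) : x ∈ (LinearMap.range f)ᗮ ↔ LinearMap.adjoint f x = 0 := by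
    rw [Submodule.mem_orthogonal, ← inner_self_eq_zero (𝕜 := ℝ)]
    constructor
    · intro h
      rw [LinearMap.adjoint_inner_right]
      exact h _ (LinearMap.mem_range_self f _)
    · rintro h _ ⟨w, rfl⟩
      rw [← LinearMap.adjoint_inner_right, inner_self_eq_zero.mp h, inner_zero_right]
  ext x
  rw [Submodule.mem_inf, mem_orthogonal]
  simp only [LinearMap.mem_ker, LinearMap.add_apply, LinearMap.comp_apply]
  constructor
  · intro h
    have hsum : inner ℝ (LinearMap.adjoint f x) (LinearMap.adjoint f x) +
        inner ℝ (g x) (g x) = 0 := by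
      rw [LinearMap.adjoint_inner_right, ← LinearMap.adjoint_inner_left g, ← inner_add_left, h,
        inner_zero_left]
    rwa [add_eq_zero_iff_of_nonneg real_inner_self_nonneg real_inner_self_nonneg,
      inner_self_eq_zero, inner_self_eq_zero] at hsum
  · rintro ⟨hf, hg⟩
    rw [hf, hg, map_zero, map_zero, add_zero]


/-- Combinatorial Hodge theorem: if `g ∘ f = 0`, the dimension of the kernel of the
Laplacian `Δ = f ∘ f* + g* ∘ g` equals `dim (ker g) - dim (range f)`, the Betti number. -/
theorem finrank_ker_laplacian_eq_betti
    {U V W : Type*}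
    [NormedAddCommGroup U] [InnerProductSpace ℝ U] [FiniteDimensional ℝ U]
    [NormedAddCommGroup V] [InnerProductSpace ℝ V] [FiniteDimensional ℝ V]
    [NormedAddCommGroup W] [InnerProductSpace ℝ W] [FiniteDimensional ℝ W]
    (f : W →ₗ[ℝ] V) (g : V →ₗ[ℝ] U) (hgf : g ∘ₗ f = 0) :
    Module.finrank ℝ
        (LinearMap.ker (f ∘ₗ LinearMap.adjoint f + LinearMap.adjoint g ∘ₗ g)) =
      Module.finrank ℝ (LinearMap.ker g) - Module.finrank ℝ (LinearMap.range f) := by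
  rw [ker_laplacian_eq_orthogonal_range_inf_ker,
    ← Submodule.finrank_add_inf_finrank_orthogonal (LinearMap.range_le_ker_iff.mpr hgf),
    Nat.add_sub_cancel_left]
end

section
/- Let $B_1$ be a real $n_0\times n_1$ matrix and $B_2$ a real $n_1\times n_2$ matrix with $B_1 B_2 = 0$. Then the dimension of the kernel of the linear map $x \mapsto (B_2 B_2^T + B_1^T B_1)x$ on $\mathbb{R}^{n_1}$ equals $\dim\ker(x \mapsto B_1 x) - \operatorname{rank}(B_2)$. -/
open Matrix

/-- The kernel of the Laplacian matrix consists of the harmonic vectors. -/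
theorem ker_laplacian_matrix {m n p : Type*} [Fintype m] [Fintype n] [Fintype p]
    (B1 : Matrix m n ℝ) (B2 : Matrix n p ℝ) :
    LinearMap.ker (B2 * B2ᵀ + B1ᵀ * B1).mulVecLin =
      LinearMap.ker B2ᵀ.mulVecLin ⊓ LinearMap.ker B1.mulVecLin := by
  have hL : B2 * B2ᵀ + B1ᵀ * B1 = (fromRows B2ᵀ B1)ᵀ * fromRows B2ᵀ B1 := by
    rw [transpose_fromRows, fromCols_mul_fromRows, transpose_transpose]
  rw [hL, ker_mulVecLin_transpose_mul_self]
  ext x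
  simp [fromRows_mulVec, ← Sum.elim_zero_zero, Sum.elim_eq_iff, mulVec_transpose]

/-- If `B1 * B2 = 0`, then `B2ᵀ` already attains its full range on the kernel of `B1`. -/
theorem finrank_map_ker_transpose {m n p : Type*} [Fintype m] [Fintype n] [Fintype p]
    (B1 : Matrix m n ℝ) (B2 : Matrix n p ℝ) (h : B1 * B2 = 0) :
    Module.finrank ℝ ((LinearMap.ker B1.mulVecLin).map B2ᵀ.mulVecLin) = B2.rank := by
  apply le_antisymm
  · rw [← rank_transpose B2]
    exact Submodule.finrank_mono LinearMap.map_le_range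
  · rw [← rank_transpose_mul_self B2]
    refine Submodule.finrank_mono ?_
    rintro _ ⟨x, rfl⟩
    exact ⟨B2 *ᵥ x, by simp [h], by simp⟩

/-- If `B₁ B₂ = 0`, the multiplicity of the eigenvalue `0` of the Laplacian matrix
`L = B₂ B₂ᵀ + B₁ᵀ B₁` equals the Betti number `dim ker B₁ - rank B₂`. -/
theorem finrank_ker_laplacian_matrix_eq_betti
    (n0 n1 n2 : ℕ) (B1 : Matrix (Fin n0) (Fin n1) ℝ) (B2 : Matrix (Fin n1) (Fin n2) ℝ)
    (h : B1 * B2 = 0) :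
    Module.finrank ℝ (LinearMap.ker (B2 * B2ᵀ + B1ᵀ * B1).mulVecLin) =
      Module.finrank ℝ (LinearMap.ker B1.mulVecLin) - B2.rank := by
  rw [ker_laplacian_matrix]
  have hrank := LinearMap.finrank_range_add_finrank_ker
    (B2ᵀ.mulVecLin.domRestrict (LinearMap.ker B1.mulVecLin))
  rw [LinearMap.range_domRestrict, finrank_map_ker_transpose B1 B2 h,
    LinearMap.ker_domRestrict] at hrank
  have hker := (Submodule.equivSubtypeMap _ (Submodule.comap
    (LinearMap.ker B1.mulVecLin).subtype (LinearMap.ker B2ᵀ.mulVecLin))).finrank_eq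
  rw [Submodule.map_comap_subtype, inf_comm] at hker
  omega
end

section
/- Let $U$, $V$, $W$ be finite-dimensional real inner product spaces, $f : W \to V$ and $g : V \to U$ linear maps with $g \circ f = 0$, and let $A \subseteq V$ be a subspace. Let $W' = f^{-1}(A) \subseteq W$, let $f' : W' \to A$ be the restriction of $f$, and let $g' : A \to U$ be the restriction of $g$; give $W'$ and $A$ the inner products inherited from $W$ and $V$. Define the persistent Laplacian $\Delta = f' \circ (f')^* + (g')^* \circ g' : A \to A$. Then $\dim\ker\Delta = \dim(A \cap \ker g) - \dim(A \cap \operatorname{range} f)$. -/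
/-- The kernel of the Laplacian `S ∘ S* + T* ∘ T` is `(range S)ᗮ ⊓ ker T`. -/
theorem LinearMap.ker_comp_adjoint_add_adjoint_comp
    {E F G : Type*}
    [NormedAddCommGroup E] [InnerProductSpace ℝ E] [FiniteDimensional ℝ E]
    [NormedAddCommGroup F] [InnerProductSpace ℝ F] [FiniteDimensional ℝ F]
    [NormedAddCommGroup G] [InnerProductSpace ℝ G] [FiniteDimensional ℝ G]
    (S : E →ₗ[ℝ] F) (T : F →ₗ[ℝ] G) :
    LinearMap.ker (S ∘ₗ LinearMap.adjoint S + LinearMap.adjoint T ∘ₗ T) =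
      (LinearMap.range S)ᗮ ⊓ LinearMap.ker T := by
  rw [LinearMap.orthogonal_range]
  ext x
  simp only [Submodule.mem_inf, LinearMap.mem_ker, LinearMap.add_apply, LinearMap.comp_apply]
  constructor
  · intro h
    have hx : inner ℝ (LinearMap.adjoint S x) (LinearMap.adjoint S x) +
        inner ℝ (T x) (T x) = 0 := by
      rw [LinearMap.adjoint_inner_left, ← LinearMap.adjoint_inner_right, ← inner_add_right, h,
        inner_zero_right]
    have h₁ := real_inner_self_nonneg (x := LinearMap.adjoint S x)
    have h₂ := real_inner_self_nonneg (x := T x)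
    exact ⟨inner_self_eq_zero.1 (by linarith : inner ℝ _ _ = (0 : ℝ)),
      inner_self_eq_zero.1 (by linarith : inner ℝ _ _ = (0 : ℝ))⟩
  · rintro ⟨h₁, h₂⟩
    simp [h₁, h₂]


/-- Persistent Hodge theorem: the dimension of the kernel of the persistent Laplacian
`Δ = f' ∘ (f')* + (g')* ∘ g'` on the subspace `A` equals the persistent Betti number
`dim (A ⊓ ker g) - dim (A ⊓ range f)`. -/
theorem finrank_ker_persistent_laplacian_eq_persistent_betti
    {U V W : Type*}
    [NormedAddCommGroup U] [InnerProductSpace ℝ U] [FiniteDimensional ℝ U]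
    [NormedAddCommGroup V] [InnerProductSpace ℝ V] [FiniteDimensional ℝ V]
    [NormedAddCommGroup W] [InnerProductSpace ℝ W] [FiniteDimensional ℝ W]
    (f : W →ₗ[ℝ] V) (g : V →ₗ[ℝ] U) (hgf : g ∘ₗ f = 0) (A : Submodule ℝ V)
    (f' : ↥(A.comap f) →ₗ[ℝ] ↥A)
    (hf' : f' = f.restrict (fun _ hx => hx))
    (g' : ↥A →ₗ[ℝ] U) (hg' : g' = g.domRestrict A) :
    Module.finrank ℝ
        (LinearMap.ker (f' ∘ₗ LinearMap.adjoint f' + LinearMap.adjoint g' ∘ₗ g')) =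
      Module.finrank ℝ ↥(A ⊓ LinearMap.ker g) -
        Module.finrank ℝ ↥(A ⊓ LinearMap.range f) := by
  subst hf' hg'
  have hrange : (LinearMap.range (f.restrict (p := A.comap f) (q := A) fun _ hx => hx)).map
      A.subtype = A ⊓ LinearMap.range f := by
    ext v
    constructor
    · rintro ⟨_, ⟨w, rfl⟩, rfl⟩
      exact ⟨w.2, w.1, rfl⟩
    · rintro ⟨hv, w, rfl⟩
      exact ⟨⟨f w, hv⟩, ⟨⟨w, hv⟩, rfl⟩, rfl⟩
  have hker : (LinearMap.ker (g.domRestrict A)).map A.subtype = A ⊓ LinearMap.ker g := by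
    ext v
    constructor
    · rintro ⟨a, ha, rfl⟩
      exact ⟨a.2, ha⟩
    · rintro ⟨hv, hgv⟩
      exact ⟨⟨v, hv⟩, hgv, rfl⟩
  have hle : LinearMap.range (f.restrict (p := A.comap f) (q := A) fun _ hx => hx) ≤
      LinearMap.ker (g.domRestrict A) := by
    rintro _ ⟨w, rfl⟩
    exact LinearMap.congr_fun hgf w.1
  rw [LinearMap.ker_comp_adjoint_add_adjoint_comp, ← hrange, ← hker,
    Submodule.finrank_map_subtype_eq, Submodule.finrank_map_subtype_eq,
    ← Submodule.finrank_add_inf_finrank_orthogonal hle, Nat.add_sub_cancel_left]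
end

section
/- The real symmetric $4\times 4$ matrix $M_1 = \begin{pmatrix} 2&1&-1&0\\ 1&2&0&-1\\ -1&0&2&1\\ 0&-1&1&2 \end{pmatrix}$ has characteristic polynomial $X\,(X-2)^2\,(X-4)$. In particular, $M_1$ and the matrix $M_2 = \begin{pmatrix} 2&1&1&0\\ 1&2&0&1\\ 1&0&2&1\\ 0&1&1&2 \end{pmatrix}$ have equal characteristic polynomials, hence identical spectra (eigenvalues $0,2,2,4$ with multiplicity). -/
open Polynomial

/-- The Laplacian-type matrix `2 + A`, where `A` is the adjacency matrix of the `4`-cycle with two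
opposite edges of weight `ε`, `ε ^ 2 = 1`, has characteristic polynomial `X (X - 2)² (X - 4)`. -/
theorem charpoly_signed_square (ε : ℝ) (hε : ε ^ 2 = 1) :
    (!![2, 1, ε, 0;
        1, 2, 0, ε;
        ε, 0, 2, 1;
        0, ε, 1, 2] : Matrix (Fin 4) (Fin 4) ℝ).charpoly = X * (X - 2) ^ 2 * (X - 4) := by
  have hC : (C ε : ℝ[X]) ^ 2 = 1 := by rw [← C_pow, hε, C_1]
  have h2 : (C 2 : ℝ[X]) = 2 := rfl
  simp [Matrix.charpoly, Matrix.charmatrix_apply, Matrix.det_succ_row_zero, Fin.sum_univ_succ,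
    Fin.succAbove, Matrix.submatrix_apply, Matrix.diagonal_apply, h2]
  linear_combination (C ε ^ 2 - 2 * (X - 2) ^ 2 - 1) * hC

/-- The `1`st directed flag Laplacians `M₁` of `G₁` and `M₂` of `G₂` have the same
characteristic polynomial `X (X-2)² (X-4)`, hence identical spectra. -/
theorem G1_G2_flag_L1_same_charpoly :
    let M1 : Matrix (Fin 4) (Fin 4) ℝ :=
      !![ 2, 1,-1, 0;
          1, 2, 0,-1;
         -1, 0, 2, 1;
          0,-1, 1, 2]
    let M2 : Matrix (Fin 4) (Fin 4) ℝ :=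
      !![2, 1, 1, 0;
         1, 2, 0, 1;
         1, 0, 2, 1;
         0, 1, 1, 2]
    M1.charpoly = X * (X - 2) ^ 2 * (X - 4) ∧ M1.charpoly = M2.charpoly := by
  intro M1 M2
  have h1 : M1.charpoly = X * (X - 2) ^ 2 * (X - 4) := charpoly_signed_square (-1) (by norm_num)
  exact ⟨h1, h1.trans (charpoly_signed_square 1 (by norm_num)).symm⟩
end
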